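/- Let I be a cofinite ideal of O₀. Then there exist an integer r ≥ 1 and nonzero vectors λ_1, …, λ_r ∈ ℂⁿ such that every polynomial p ∈ P satisfying p(0) = 0 and (∂_{λ_{j_1}} ⋯ ∂_{λ_{j_l}} p)(0) = 0 for every 1 ≤ l ≤ r and every strictly increasing sequence 1 ≤ j_1 < ⋯ < j_l ≤ r, has its germ ι(p) in I. (This is the statement ker(ᾱ_r^*) ⊆ I of the paper, via the paper's explicit description of this kernel.) -/

import Mathlib

open Filter Topology

noncomputable section

namespace PaleyWiener

/-- The `ℂ`-algebra structure on germs of `ℂ`-valued functions, via constant germs. -/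
instance germAlgebra {α : Type*} {l : Filter α} : Algebra ℂ (Filter.Germ l ℂ) :=
  Algebra.ofModule
    (fun c x y => by
      refine x.inductionOn fun f => y.inductionOn fun g => ?_
      rw [← Filter.Germ.coe_smul, ← Filter.Germ.coe_mul, ← Filter.Germ.coe_mul,
        ← Filter.Germ.coe_smul, smul_mul_assoc])
    (fun c x y => by
      refine x.inductionOn fun f => y.inductionOn fun g => ?_
      rw [← Filter.Germ.coe_smul, ← Filter.Germ.coe_mul, ← Filter.Germ.coe_mul,
        ← Filter.Germ.coe_smul, mul_smul_comm])

variable (n : ℕ)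

/-- The ring of germs at `0` of holomorphic functions on `ℂⁿ`, realized as the subalgebra of
`Filter.Germ (𝓝 0) ℂ` of germs admitting a representative analytic at `0`. -/
def O0 : Subalgebra ℂ (Filter.Germ (𝓝 (0 : Fin n → ℂ)) ℂ) where
  carrier := {g | ∃ f : (Fin n → ℂ) → ℂ, AnalyticAt ℂ f 0 ∧ g = ↑f}
  mul_mem' := by
    rintro a b ⟨f, hf, rfl⟩ ⟨g, hg, rfl⟩
    exact ⟨f * g, hf.mul hg, rfl⟩
  add_mem' := by
    rintro a b ⟨f, hf, rfl⟩ ⟨g, hg, rfl⟩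
    exact ⟨f + g, hf.add hg, rfl⟩
  algebraMap_mem' := fun c => ⟨fun _ => c, analyticAt_const, by
    rw [Algebra.algebraMap_eq_smul_one]
    have h : ((fun _ : Fin n → ℂ => c) : (Fin n → ℂ) → ℂ) = c • (1 : (Fin n → ℂ) → ℂ) := by
      funext x; simp
    rw [h, Filter.Germ.coe_smul, Filter.Germ.coe_one]⟩

/-- Evaluation at `0` of a germ at `𝓝 0`, as a ring homomorphism; this is well defined
since every neighborhood of `0` contains `0`. -/
def germEval0 : Filter.Germ (𝓝 (0 : Fin n → ℂ)) ℂ →+* ℂ where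
  toFun g := g.liftOn (fun f => f 0) fun _ _ h => h.self_of_nhds
  map_one' := rfl
  map_mul' a b := a.inductionOn₂ b fun _ _ => rfl
  map_zero' := rfl
  map_add' a b := a.inductionOn₂ b fun _ _ => rfl

/-- Evaluation at `0` on `O₀`. -/
def evalO0 : O0 n →+* ℂ := (germEval0 n).comp ((O0 n).val : O0 n →ₐ[ℂ] _).toRingHom

/-- The maximal ideal `M` of `O₀`, consisting of the germs vanishing at `0`. -/
def Mideal : Ideal (O0 n) := RingHom.ker (evalO0 n)

end PaleyWiener

namespace PaleyWiener

/-- The germ at `0` of the `i`-th coordinate function on `ℂⁿ`, as an element of `O₀`. -/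
def coordGerm (n : ℕ) (i : Fin n) : O0 n :=
  ⟨(↑(fun x : Fin n → ℂ => x i) : Filter.Germ (nhds (0 : Fin n → ℂ)) ℂ),
    fun x : Fin n → ℂ => x i, by
      have h := (ContinuousLinearMap.proj (R := ℂ) (φ := fun _ : Fin n => ℂ) i).analyticAt
        (0 : Fin n → ℂ)
      exact h, rfl⟩

/-- The `ℂ`-algebra homomorphism `ι : P → O₀` sending a polynomial `p` to the germ at `0`
of its evaluation function on `ℂⁿ` (determined by sending each variable `Xᵢ` to the germ of
the `i`-th coordinate function). -/
def iota (n : ℕ) : MvPolynomial (Fin n) ℂ →ₐ[ℂ] O0 n :=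
  MvPolynomial.aeval (coordGerm n)

end PaleyWiener

namespace PaleyWiener

/-- The directional derivative `∂_λ` on `P = ℂ[x₁,…,xₙ]` along `λ ∈ ℂⁿ`:
`∂_λ p = Σᵢ λᵢ • (pderiv i p)`. -/
def dirDeriv (n : ℕ) (lam : Fin n → ℂ) (p : MvPolynomial (Fin n) ℂ) :
    MvPolynomial (Fin n) ℂ :=
  ∑ i, lam i • MvPolynomial.pderiv i p

theorem coeff_foldr_dirDeriv (n : ℕ) (L : List (Fin n)) (p : MvPolynomial (Fin n) ℂ) :
    ∀ m : Fin n →₀ ℕ, ∃ c : ℂ, c ≠ 0 ∧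
      MvPolynomial.coeff m
        ((L.map fun i => (Pi.single i 1 : Fin n → ℂ)).foldr (dirDeriv n) p) =
      c * MvPolynomial.coeff (m + (L.map fun i => Finsupp.single i 1).sum) p := by
  induction L with
  | nil => intro m; exact ⟨1, one_ne_zero, by simp⟩
  | cons i L ih =>
    intro m
    obtain ⟨c, hc, h⟩ := ih (m + Finsupp.single i 1)
    refine ⟨((m i : ℂ) + 1) * c, mul_ne_zero (Nat.cast_add_one_ne_zero _) hc, ?_⟩
    have hd : ∀ q, dirDeriv n (Pi.single i 1 : Fin n → ℂ) q = MvPolynomial.pderiv i q := by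
      intro q
      unfold dirDeriv
      rw [Finset.sum_eq_single i]
      · simp
      · intro b _ hb; simp [hb]
      · simp
    rw [List.map_cons, List.foldr_cons, hd, MvPolynomial.coeff_pderiv, h, List.map_cons,
      List.sum_cons, add_assoc]
    ring

theorem isUnit_of_eval_ne_zero (n : ℕ) (g : O0 n) (h : evalO0 n g ≠ 0) : IsUnit g := by
  obtain ⟨_, f, hf, rfl⟩ := g
  have h0 : f 0 ≠ 0 := h
  refine IsUnit.of_mul_eq_one
    (⟨((f⁻¹ : (Fin n → ℂ) → ℂ) : Filter.Germ (𝓝 (0 : Fin n → ℂ)) ℂ), f⁻¹, hf.inv h0, rfl⟩ : O0 n) ?_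
  apply Subtype.ext
  change ((f * f⁻¹ : (Fin n → ℂ) → ℂ) : Filter.Germ (𝓝 (0 : Fin n → ℂ)) ℂ) =
    ((1 : (Fin n → ℂ) → ℂ) : Filter.Germ (𝓝 (0 : Fin n → ℂ)) ℂ)
  rw [Filter.Germ.coe_eq]
  filter_upwards [hf.continuousAt.eventually_ne h0] with x hx
  simp [hx]

theorem evalO0_algebraMap (n : ℕ) (c : ℂ) : evalO0 n (algebraMap ℂ (O0 n) c) = c := by
  rw [Algebra.algebraMap_eq_smul_one]
  change c • (1 : ℂ) = c
  simp

set_option synthInstance.maxHeartbeats 1000000 in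
theorem exists_pow_mem (n : ℕ) (I : Ideal (O0 n))
    (hI : FiniteDimensional ℂ (O0 n ⧸ I)) (i : Fin n) : ∃ m : ℕ, coordGerm n i ^ m ∈ I := by
  obtain ⟨q, hq, h⟩ : IsAlgebraic ℂ (Ideal.Quotient.mkₐ ℂ I (coordGerm n i)) :=
    (Algebra.IsIntegral.isIntegral (R := ℂ) _).isAlgebraic
  rw [Polynomial.aeval_algHom_apply, Ideal.Quotient.mkₐ_eq_mk, Ideal.Quotient.eq_zero_iff_mem] at h
  obtain ⟨u, hu, hn⟩ := Polynomial.exists_eq_pow_rootMultiplicity_mul_and_not_dvd q hq 0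
  refine ⟨q.rootMultiplicity 0, ?_⟩
  generalize q.rootMultiplicity 0 = k at *
  rw [hu] at h
  simp only [Polynomial.C_0, sub_zero, map_mul, map_pow, Polynomial.aeval_X] at h hn
  have hunit : IsUnit (Polynomial.aeval (coordGerm n i) u) := by
    apply isUnit_of_eval_ne_zero
    rw [← Polynomial.divX_mul_X_add u]
    have h0 : evalO0 n (coordGerm n i) = 0 := rfl
    rw [map_add, map_mul, map_add, map_mul, Polynomial.aeval_X, h0, Polynomial.aeval_C,
      evalO0_algebraMap]
    simpa [Polynomial.X_dvd_iff] using hn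
  exact (Ideal.mul_unit_mem_iff_mem I hunit).1 h

set_option synthInstance.maxHeartbeats 1000000 in
/-- For every cofinite ideal `I` of `O₀` there exist `r ≥ 1` and nonzero
vectors `λ₁, …, λ_r ∈ ℂⁿ` such that every polynomial `p` with `p(0) = 0` and
`(∂_{λ_{j₁}} ⋯ ∂_{λ_{j_l}} p)(0) = 0` for all `1 ≤ l ≤ r` and all strictly increasing
`1 ≤ j₁ < ⋯ < j_l ≤ r` has its germ `ι(p)` in `I`. -/
theorem ker_alphaBar_subset_cofinite_ideal (n : ℕ) (hn : 1 ≤ n) (I : Ideal (O0 n))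
    (hI : FiniteDimensional ℂ (O0 n ⧸ I)) :
    ∃ (r : ℕ), 1 ≤ r ∧ ∃ lam : Fin r → (Fin n → ℂ), (∀ j, lam j ≠ 0) ∧
      ∀ p : MvPolynomial (Fin n) ℂ,
        MvPolynomial.constantCoeff p = 0 →
        (∀ (l : ℕ), 1 ≤ l → l ≤ r → ∀ j : Fin l → Fin r, StrictMono j →
          MvPolynomial.constantCoeff
            ((List.ofFn fun m : Fin l => lam (j m)).foldr (dirDeriv n) p) = 0) →
        iota n p ∈ I := by
  choose m hm using exists_pow_mem n I hI
  set N := ∑ i, m i + 1 with hN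
  refine ⟨n * N, Nat.mul_pos hn (Nat.succ_pos _), fun j => Pi.single j.divNat 1, ?_, ?_⟩
  · intro j; simp
  intro p hp0 hp
  have key : ∀ a : Fin n →₀ ℕ, (∀ i, a i ≤ N) → MvPolynomial.coeff a p = 0 := by
    intro a ha
    let S : Finset (Fin (n * N)) := Finset.univ.filter fun j => (j.modNat : ℕ) < a j.divNat
    have hsum : ∑ j ∈ S, Finsupp.single j.divNat 1 = a := by
      rw [Finset.sum_filter, ← finProdFinEquiv.sum_comp, Fintype.sum_prod_type]
      have : ∀ x : Fin n × Fin N, (finProdFinEquiv x).divNat = x.1 ∧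
          (finProdFinEquiv x).modNat = x.2 := fun x =>
        Prod.ext_iff.1 (finProdFinEquiv.symm_apply_apply x)
      simp only [this]
      ext i
      simp only [Finsupp.finsetSum_apply]
      rw [Finset.sum_eq_single i]
      · have h1 : ∀ y : Fin N, (if (y : ℕ) < a i then Finsupp.single i 1 else (0 : Fin n →₀ ℕ)) i
            = if (y : ℕ) < a i then 1 else 0 := by
          intro y; split_ifs <;> simp
        simp only [h1]
        rw [Fin.sum_univ_eq_sum_range (fun y => if y < a i then 1 else 0) N, ← Finset.sum_filter,
          Finset.sum_const, smul_eq_mul, mul_one]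
        have : (Finset.range N).filter (fun y => y < a i) = Finset.range (a i) := by
          ext y
          have := ha i
          simp only [Finset.mem_filter, Finset.mem_range]
          omega
        rw [this, Finset.card_range]
      · intro b _ hb
        refine Finset.sum_eq_zero fun y _ => ?_
        split_ifs
        · simp [Ne.symm hb]
        · simp
      · simp
    rcases Nat.eq_zero_or_pos S.card with h0 | h0
    · rw [Finset.card_eq_zero] at h0
      rw [h0, Finset.sum_empty] at hsum
      rw [← hsum]
      exact hp0
    · have hl : S.card ≤ n * N := by simpa using S.card_le_univ
      have := hp S.card h0 hl (S.orderEmbOfFin rfl) (S.orderEmbOfFin rfl).strictMono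
      obtain ⟨c, hc, h⟩ := coeff_foldr_dirDeriv n
        (List.ofFn fun k : Fin S.card => (S.orderEmbOfFin rfl k).divNat) p 0
      rw [List.map_ofFn, List.map_ofFn, List.sum_ofFn] at h
      have hs : ∑ k : Fin S.card,
          ((fun i : Fin n => (Finsupp.single i 1 : Fin n →₀ ℕ)) ∘
            fun k : Fin S.card => (S.orderEmbOfFin rfl k).divNat) k = a := by
        rw [← hsum]
        conv_rhs => rw [← Finset.map_orderEmbOfFin_univ S rfl, Finset.sum_map]
        rfl
      rw [hs, zero_add] at h
      have h2 := h.symm.trans this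
      exact (mul_eq_zero.1 h2).resolve_left hc
  rw [p.as_sum, map_sum]
  refine I.sum_mem fun a ha => ?_
  obtain ⟨i, hi⟩ : ∃ i, N < a i := by
    by_contra! hcon
    exact (MvPolynomial.mem_support_iff.1 ha) (key a hcon)
  have hle : m i ≤ a i := by
    have := Finset.single_le_sum (f := m) (fun _ _ => Nat.zero_le _) (Finset.mem_univ i)
    omega
  unfold iota
  rw [MvPolynomial.aeval_monomial, Finsupp.prod_fintype _ _ (fun _ => pow_zero _)]
  refine I.mul_mem_left _ ?_
  exact Ideal.mem_of_dvd I ((pow_dvd_pow _ hle).trans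
    (Finset.dvd_prod_of_mem (fun i => coordGerm n i ^ a i) (Finset.mem_univ i))) (hm i)

end PaleyWiener
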